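/- arXiv:2411.17929 — 2 statements merged into one kernel-verified Lean document; each statement's English description precedes it below -/
import Mathlib

section
/- Let Ū ∈ C_c^∞(ℝ³;ℝ³) be divergence-free, set ū(x,t) := t^{-1/2}·Ū(x/√t), and let θ be an admissible solution on [1,∞) of ∂ₜθ = Δθ − ū·∇θ. Then for every integer k ≥ 1 there exists a constant C = C(k, Ū) such that for all t > 1: (t−1)^k·‖∇^k θ(·,t)‖²_{L²(ℝ³)} ≤ C·(t−1)^{k−1}·∫₁^t ‖θ(·,s)‖²_{H^k} ds. -/
noncomputable section

open MeasureTheory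
open scoped ENNReal BigOperators

/-- Three-dimensional Euclidean space. -/
abbrev E3 : Type := EuclideanSpace ℝ (Fin 3)

/-- Spatial partial derivative `∂ᵢ F` of a scalar function. -/
noncomputable def pd (F : E3 → ℝ) (i : Fin 3) (x : E3) : ℝ :=
  fderiv ℝ F x (EuclideanSpace.single i 1)

/-- Laplacian `ΔF` of a scalar function. -/
noncomputable def lap (F : E3 → ℝ) (x : E3) : ℝ :=
  ∑ i, pd (fun y => pd F i y) i x

/-- Spatial divergence `∇·u` of a vector field. -/
noncomputable def divg (u : E3 → E3) (x : E3) : ℝ :=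
  ∑ i, pd (fun y => u y i) i x

/-- The self-similar velocity field `ū(x,t) = t^{-1/2} Ū(x/√t)`. -/
noncomputable def ubar (Ubar : E3 → E3) (x : E3) (t : ℝ) : E3 :=
  (t ^ (-(1:ℝ)/2)) • Ubar ((t ^ (-(1:ℝ)/2)) • x)

/-- The squared Sobolev `H^m` norm `∑_{j=0}^m ∫ ‖∇ʲ g‖²`. -/
noncomputable def sobSq (m : ℕ) (g : E3 → ℝ) : ℝ :=
  ∑ j ∈ Finset.range (m + 1), ∫ x : E3, ‖iteratedFDeriv ℝ j g x‖ ^ 2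

/-- `θ` is an admissible solution on `ℝ³ × [1,∞)` of the advected heat equation
`∂ₜθ = Δθ − ū·∇θ`: it is smooth, solves the equation pointwise, and together with all
its spatial derivatives decays in `x` faster than any polynomial, locally uniformly
in `t`. -/
def IsAdmissible (Ubar : E3 → E3) (θ : E3 → ℝ → ℝ) : Prop :=
  ContDiffOn ℝ (⊤ : ℕ∞) (fun q : E3 × ℝ => θ q.1 q.2) {q : E3 × ℝ | 1 ≤ q.2} ∧
  (∀ (x : E3) (t : ℝ), 1 ≤ t →
    deriv (fun s => θ x s) t
      = lap (fun y => θ y t) x - ∑ i, ubar Ubar x t i * pd (fun y => θ y t) i x) ∧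
  (∀ (n k : ℕ) (T : ℝ), ∃ C : ℝ, ∀ (x : E3) (t : ℝ), 1 ≤ t → t ≤ T →
    ‖x‖ ^ n * ‖iteratedFDeriv ℝ k (fun y => θ y t) x‖ ≤ C)

/-- Iterated spatial partial derivative along a list of coordinate directions. -/
def iterPd : List (Fin 3) → (E3 → ℝ) → E3 → ℝ
  | [], F => F
  | i :: l, F => fun x => pd (iterPd l F) i x

theorem contDiff_pd {F : E3 → ℝ} (hF : ContDiff ℝ (⊤ : ℕ∞) F) (i : Fin 3) :
    ContDiff ℝ (⊤ : ℕ∞) (fun x => pd F i x) :=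
  (hF.fderiv_right (m := (⊤ : ℕ∞)) (by simp)).clm_apply contDiff_const

theorem contDiff_iterPd {F : E3 → ℝ} (hF : ContDiff ℝ (⊤ : ℕ∞) F) (l : List (Fin 3)) :
    ContDiff ℝ (⊤ : ℕ∞) (iterPd l F) := by
  induction l with
  | nil => exact hF
  | cons i l ih => exact contDiff_pd ih i

theorem contDiff_lap {F : E3 → ℝ} (hF : ContDiff ℝ (⊤ : ℕ∞) F) :
    ContDiff ℝ (⊤ : ℕ∞) (lap F) :=
  ContDiff.sum fun i _ => contDiff_pd (contDiff_pd hF i) i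

theorem pd_comm {F : E3 → ℝ} (hF : ContDiff ℝ (⊤ : ℕ∞) F) (i j : Fin 3) (x : E3) :
    pd (fun y => pd F i y) j x = pd (fun y => pd F j y) i x := by
  have hd : Differentiable ℝ (fderiv ℝ F) :=
    (hF.fderiv_right (m := 1) (by norm_cast)).differentiable (by simp)
  have key : ∀ i j : Fin 3, pd (fun y => pd F i y) j x
      = fderiv ℝ (fderiv ℝ F) x (EuclideanSpace.single j 1) (EuclideanSpace.single i 1) := by
    intro i j
    unfold pd
    rw [fderiv_clm_apply (hd x) (differentiableAt_const _)]
    simp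
  rw [key, key]
  exact (hF.contDiffAt.isSymmSndFDerivAt (by simp; norm_cast)) _ _

theorem pd_sub {F G : E3 → ℝ} (hF : ContDiff ℝ (⊤ : ℕ∞) F) (hG : ContDiff ℝ (⊤ : ℕ∞) G)
    (i : Fin 3) (x : E3) : pd (fun y => F y - G y) i x = pd F i x - pd G i x := by
  unfold pd
  rw [fderiv_fun_sub (hF.differentiable (by simp) x) (hG.differentiable (by simp) x)]
  simp

theorem pd_sum {ι : Type*} (s : Finset ι) {F : ι → E3 → ℝ}
    (hF : ∀ r, ContDiff ℝ (⊤ : ℕ∞) (F r)) (i : Fin 3) (x : E3) :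
    pd (fun y => ∑ r ∈ s, F r y) i x = ∑ r ∈ s, pd (F r) i x := by
  unfold pd
  rw [fderiv_fun_sum fun r _ => (hF r).differentiable (by simp) x]
  simp

theorem iterPd_sub {F G : E3 → ℝ} (hF : ContDiff ℝ (⊤ : ℕ∞) F) (hG : ContDiff ℝ (⊤ : ℕ∞) G)
    (l : List (Fin 3)) :
    iterPd l (fun y => F y - G y) = fun x => iterPd l F x - iterPd l G x := by
  induction l with
  | nil => rfl
  | cons i l ih =>
    funext x
    simp only [iterPd, ih]
    exact pd_sub (contDiff_iterPd hF l) (contDiff_iterPd hG l) i x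

theorem pd_lap {F : E3 → ℝ} (hF : ContDiff ℝ (⊤ : ℕ∞) F) (i : Fin 3) (x : E3) :
    pd (lap F) i x = lap (fun y => pd F i y) x := by
  unfold lap
  rw [pd_sum _ (fun r => contDiff_pd (contDiff_pd hF r) r)]
  refine Finset.sum_congr rfl fun r _ => ?_
  rw [pd_comm (contDiff_pd hF r)]
  congr 1
  funext y
  exact pd_comm hF r i y

theorem iterPd_lap {F : E3 → ℝ} (hF : ContDiff ℝ (⊤ : ℕ∞) F) (l : List (Fin 3)) :
    iterPd l (lap F) = lap (iterPd l F) := by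
  induction l with
  | nil => rfl
  | cons i l ih =>
    funext x
    simp only [iterPd, ih]
    exact pd_lap (contDiff_iterPd hF l) i x

theorem iterPd_ofFn {F : E3 → ℝ} (hF : ContDiff ℝ (⊤ : ℕ∞) F) {n : ℕ} (α : Fin n → Fin 3)
    (x : E3) : iterPd (List.ofFn α) F x
      = iteratedFDeriv ℝ n F x (fun r => EuclideanSpace.single (α r) 1) := by
  induction n generalizing x with
  | zero => simp [iterPd]
  | succ n ih =>
    rw [List.ofFn_succ, iteratedFDeriv_succ_apply_left]
    have : iterPd (List.ofFn fun i => α i.succ) F = fun y => iteratedFDeriv ℝ n F y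
        (fun r => EuclideanSpace.single (α r.succ) 1) := funext fun y => ih _ y
    simp only [iterPd, this, pd]
    have hd : DifferentiableAt ℝ (iteratedFDeriv ℝ n F) x :=
      hF.differentiable_iteratedFDeriv (by norm_cast; exact ENat.natCast_lt_top n) x
    rw [fderiv_continuousMultilinear_apply_const hd]
    rfl

theorem abs_iterPd_le {F : E3 → ℝ} (hF : ContDiff ℝ (⊤ : ℕ∞) F) (l : List (Fin 3)) (x : E3) :
    |iterPd l F x| ≤ ‖iteratedFDeriv ℝ l.length F x‖ := by
  have h := iterPd_ofFn hF l.get x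
  rw [List.ofFn_get] at h
  rw [h]
  refine ((iteratedFDeriv ℝ l.length F x).le_opNorm _).trans ?_
  simp

theorem norm_iteratedFDeriv_le_sum_iterPd {F : E3 → ℝ} (hF : ContDiff ℝ (⊤ : ℕ∞) F) (n : ℕ)
    (x : E3) :
    ‖iteratedFDeriv ℝ n F x‖ ≤ ∑ α : Fin n → Fin 3, |iterPd (List.ofFn α) F x| := by
  refine ContinuousMultilinearMap.opNorm_le_bound (Finset.sum_nonneg fun _ _ => abs_nonneg _)
    fun v => ?_
  have hv : v = fun r => ∑ j : Fin 3, v r j • EuclideanSpace.single j (1 : ℝ) := by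
    funext r
    ext k
    simp [Pi.single_apply]
  conv_lhs => rw [hv]
  rw [ContinuousMultilinearMap.map_sum, Finset.sum_mul]
  refine (norm_sum_le _ _).trans (Finset.sum_le_sum fun α _ => ?_)
  rw [ContinuousMultilinearMap.map_smul_univ, ← iterPd_ofFn hF, norm_smul, Real.norm_eq_abs,
    Real.norm_eq_abs, mul_comm, Finset.abs_prod]
  gcongr with r
  exact PiLp.norm_apply_le (v r) (α r)

theorem contDiff_ubar {U : E3 → E3} (hU : ContDiff ℝ (⊤ : ℕ∞) U) (t : ℝ) :
    ContDiff ℝ (⊤ : ℕ∞) (fun x => ubar U x t) :=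
  (hU.comp (contDiff_id.const_smul _)).const_smul _

theorem exists_norm_iteratedFDeriv_ubar_le {U : E3 → E3} (hU : ContDiff ℝ (⊤ : ℕ∞) U)
    (hUc : HasCompactSupport U) (n : ℕ) :
    ∃ M : ℝ, 0 ≤ M ∧ ∀ t : ℝ, 1 ≤ t → ∀ x : E3,
      ‖iteratedFDeriv ℝ n (fun y => ubar U y t) x‖ ≤ M * t ^ (-(1:ℝ)/2) := by
  have hn : ((n : ℕ) : WithTop ℕ∞) ≤ ((⊤ : ℕ∞) : WithTop ℕ∞) := by exact_mod_cast le_top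
  have hUn : ContDiff ℝ n U := hU.of_le hn
  obtain ⟨M, hM⟩ := (hUc.iteratedFDeriv (𝕜 := ℝ) n).exists_bound_of_continuous
    (hU.continuous_iteratedFDeriv hn)
  refine ⟨M, (norm_nonneg _).trans (hM 0), fun t ht x => ?_⟩
  set c : ℝ := t ^ (-(1:ℝ)/2) with hc
  have hc0 : 0 ≤ c := Real.rpow_nonneg (by linarith) _
  have hc1 : c ≤ 1 := Real.rpow_le_one_of_one_le_of_nonpos ht (by norm_num)
  have hcomp : ContDiff ℝ n (fun y : E3 => U (c • y)) := hUn.comp (contDiff_id.const_smul c)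
  have h1 : iteratedFDeriv ℝ n (fun y => ubar U y t) x
      = c • c ^ n • iteratedFDeriv ℝ n U (c • x) := by
    have : (fun y => ubar U y t) = fun y => c • (fun y : E3 => U (c • y)) y := rfl
    rw [this, iteratedFDeriv_const_smul_apply' hcomp.contDiffAt,
      iteratedFDeriv_comp_const_smul c hUn]
  rw [h1, norm_smul, norm_smul, norm_pow, Real.norm_of_nonneg hc0, mul_comm M]
  gcongr
  calc c ^ n * ‖iteratedFDeriv ℝ n U (c • x)‖ ≤ 1 * M :=
        mul_le_mul (pow_le_one₀ hc0 hc1) (hM _) (norm_nonneg _) zero_le_one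
    _ = M := one_mul M

/-- The advection term `u · ∇F`. -/
def advection (u : E3 → E3) (F : E3 → ℝ) (x : E3) : ℝ := ∑ i, u x i * pd F i x

theorem advection_eq_fderiv (u : E3 → E3) (F : E3 → ℝ) (x : E3) :
    advection u F x = fderiv ℝ F x (u x) := by
  have hv : u x = ∑ j : Fin 3, u x j • EuclideanSpace.single j (1 : ℝ) := by
    ext k
    simp [Pi.single_apply]
  conv_rhs => rw [hv]
  simp [advection, pd]

theorem contDiff_advection {u : E3 → E3} (hu : ContDiff ℝ (⊤ : ℕ∞) u) {F : E3 → ℝ}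
    (hF : ContDiff ℝ (⊤ : ℕ∞) F) : ContDiff ℝ (⊤ : ℕ∞) (advection u F) := by
  rw [show advection u F = fun x => fderiv ℝ F x (u x) from funext (advection_eq_fderiv u F)]
  exact (hF.fderiv_right (m := (⊤ : ℕ∞)) (by simp)).clm_apply hu

theorem exists_norm_iteratedFDeriv_advection_le {U : E3 → E3} (hU : ContDiff ℝ (⊤ : ℕ∞) U)
    (hUc : HasCompactSupport U) (m : ℕ) :
    ∃ M : ℝ, 0 ≤ M ∧ ∀ t : ℝ, 1 ≤ t → ∀ F : E3 → ℝ, ContDiff ℝ (⊤ : ℕ∞) F → ∀ x : E3,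
      ‖iteratedFDeriv ℝ m (advection (fun y => ubar U y t) F) x‖
        ≤ M * t ^ (-(1:ℝ)/2) * ∑ j ∈ Finset.range (m + 2), ‖iteratedFDeriv ℝ j F x‖ := by
  choose M hM0 hM using exists_norm_iteratedFDeriv_ubar_le hU hUc
  refine ⟨∑ i ∈ Finset.range (m + 1), (m.choose i : ℝ) * M (m - i),
    Finset.sum_nonneg fun i _ => mul_nonneg (Nat.cast_nonneg _) (hM0 _), fun t ht F hF x => ?_⟩
  have hF' : ContDiff ℝ (⊤ : ℕ∞) (fderiv ℝ F) := hF.fderiv_right (by simp)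
  rw [show advection (fun y => ubar U y t) F = fun x => fderiv ℝ F x (ubar U x t) from
    funext (advection_eq_fderiv _ F)]
  refine (norm_iteratedFDeriv_clm_apply hF' (contDiff_ubar hU t) x
    (by exact_mod_cast le_top)).trans ?_
  rw [Finset.sum_mul, Finset.sum_mul]
  refine Finset.sum_le_sum fun i hi => ?_
  have h1 : ‖iteratedFDeriv ℝ i (fderiv ℝ F) x‖
      ≤ ∑ j ∈ Finset.range (m + 2), ‖iteratedFDeriv ℝ j F x‖ := by
    rw [norm_iteratedFDeriv_fderiv]
    refine Finset.single_le_sum (f := fun j => ‖iteratedFDeriv ℝ j F x‖)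
      (fun _ _ => norm_nonneg _) ?_
    simp only [Finset.mem_range] at hi ⊢
    omega
  calc _ ≤ (m.choose i : ℝ) * (∑ j ∈ Finset.range (m + 2), ‖iteratedFDeriv ℝ j F x‖)
        * (M (m - i) * t ^ (-(1:ℝ)/2)) := by
        gcongr
        exact hM _ t ht x
    _ = _ := by ring

/-- Joint smoothness in space and time on the open set `t > 1`. -/
def SmoothAfter {G : Type*} [NormedAddCommGroup G] [NormedSpace ℝ G] (f : E3 → ℝ → G) : Prop :=
  ContDiffOn ℝ (⊤ : ℕ∞) (fun q : E3 × ℝ => f q.1 q.2) {q : E3 × ℝ | 1 < q.2}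

theorem isOpen_after : IsOpen {q : E3 × ℝ | 1 < q.2} :=
  isOpen_lt continuous_const continuous_snd

namespace SmoothAfter

variable {G : Type*} [NormedAddCommGroup G] [NormedSpace ℝ G] {f : E3 → ℝ → G}

theorem contDiffAt (hf : SmoothAfter f) (x : E3) {t : ℝ} (ht : 1 < t) :
    ContDiffAt ℝ (⊤ : ℕ∞) (fun q : E3 × ℝ => f q.1 q.2) (x, t) :=
  ContDiffOn.contDiffAt hf (isOpen_after.mem_nhds ht)

theorem hasFDerivAt (hf : SmoothAfter f) (x : E3) {t : ℝ} (ht : 1 < t) :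
    HasFDerivAt (fun q : E3 × ℝ => f q.1 q.2) (fderiv ℝ (fun q : E3 × ℝ => f q.1 q.2) (x, t))
      (x, t) :=
  ((hf.contDiffAt x ht).differentiableAt (by simp)).hasFDerivAt

theorem contDiff_space (hf : SmoothAfter f) {t : ℝ} (ht : 1 < t) :
    ContDiff ℝ (⊤ : ℕ∞) (fun x => f x t) :=
  contDiff_iff_contDiffAt.2 fun x =>
    (hf.contDiffAt x ht).comp x (contDiffAt_id.prodMk contDiffAt_const)

theorem contDiffAt_time (hf : SmoothAfter f) (x : E3) {t : ℝ} (ht : 1 < t) :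
    ContDiffAt ℝ (⊤ : ℕ∞) (f x) t :=
  (hf.contDiffAt x ht).comp t (contDiffAt_const.prodMk contDiffAt_id)

theorem hasDerivAt_time (hf : SmoothAfter f) (x : E3) {t : ℝ} (ht : 1 < t) :
    HasDerivAt (f x) (deriv (f x) t) t :=
  ((hf.contDiffAt_time x ht).differentiableAt (by simp)).hasDerivAt

theorem fderiv_space_eq (hf : SmoothAfter f) (x : E3) {t : ℝ} (ht : 1 < t) (v : E3) :
    fderiv ℝ (fun y => f y t) x v = fderiv ℝ (fun q : E3 × ℝ => f q.1 q.2) (x, t) (v, 0) := by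
  have h := (hf.hasFDerivAt x ht).comp x (hasFDerivAt_prodMk_left (𝕜 := ℝ) x t)
  change HasFDerivAt (fun y => f y t) _ x at h
  rw [h.fderiv]
  simp

theorem deriv_time_eq (hf : SmoothAfter f) (x : E3) {t : ℝ} (ht : 1 < t) :
    deriv (f x) t = fderiv ℝ (fun q : E3 × ℝ => f q.1 q.2) (x, t) (0, 1) := by
  have h := (hf.hasFDerivAt x ht).comp_hasDerivAt t
    ((hasDerivAt_const t x).prodMk (hasDerivAt_id t))
  change HasDerivAt (f x) _ t at h
  exact h.deriv

theorem contDiffOn_fderiv (hf : SmoothAfter f) :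
    ContDiffOn ℝ (⊤ : ℕ∞) (fderiv ℝ (fun q : E3 × ℝ => f q.1 q.2)) {q : E3 × ℝ | 1 < q.2} :=
  ContDiffOn.fderiv_of_isOpen hf isOpen_after (by simp)

theorem fderiv_space (hf : SmoothAfter f) :
    SmoothAfter (fun x t => fderiv ℝ (fun y => f y t) x) := by
  have h : ContDiffOn ℝ (⊤ : ℕ∞) (fun q : E3 × ℝ =>
      (fderiv ℝ (fun q : E3 × ℝ => f q.1 q.2) q).comp (ContinuousLinearMap.inl ℝ E3 ℝ))
      {q : E3 × ℝ | 1 < q.2} := hf.contDiffOn_fderiv.clm_comp contDiffOn_const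
  refine h.congr fun q hq => ?_
  ext v
  simp [hf.fderiv_space_eq q.1 hq v]

theorem deriv_time (hf : SmoothAfter f) : SmoothAfter (fun x t => deriv (f x) t) := by
  have h : ContDiffOn ℝ (⊤ : ℕ∞) (fun q : E3 × ℝ =>
      fderiv ℝ (fun q : E3 × ℝ => f q.1 q.2) q ((0 : E3), (1 : ℝ)))
      {q : E3 × ℝ | 1 < q.2} := hf.contDiffOn_fderiv.clm_apply contDiffOn_const
  exact h.congr fun q hq => hf.deriv_time_eq q.1 hq

theorem iteratedFDeriv_space (hf : SmoothAfter f) (n : ℕ) :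
    SmoothAfter (fun x t => iteratedFDeriv ℝ n (fun y => f y t) x) := by
  induction n with
  | zero =>
    simp only [iteratedFDeriv_zero_eq_comp]
    exact (continuousMultilinearCurryFin0 ℝ E3 G).symm.contDiff.comp_contDiffOn hf
  | succ n ih =>
    simp only [iteratedFDeriv_succ_eq_comp_left]
    exact (continuousMultilinearCurryLeftEquiv ℝ (fun _ : Fin (n + 1) => E3) G).symm.contDiff
      |>.comp_contDiffOn ih.fderiv_space

theorem pd {f : E3 → ℝ → ℝ} (hf : SmoothAfter f) (i : Fin 3) :
    SmoothAfter (fun x t => pd (fun y => f y t) i x) :=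
  ContDiffOn.clm_apply hf.fderiv_space contDiffOn_const

theorem deriv_pd {f : E3 → ℝ → ℝ} (hf : SmoothAfter f) (i : Fin 3) (x : E3) {t : ℝ}
    (ht : 1 < t) :
    deriv (fun s => _root_.pd (fun y => f y s) i x) t
      = _root_.pd (fun y => deriv (f y) t) i x := by
  set Φ : E3 × ℝ → ℝ := fun q => f q.1 q.2 with hΦ
  have hd : DifferentiableAt ℝ (fderiv ℝ Φ) (x, t) :=
    (hf.contDiffOn_fderiv.contDiffAt (isOpen_after.mem_nhds ht)).differentiableAt (by simp)
  have key : ∀ v w : E3 × ℝ, fderiv ℝ (fun q => fderiv ℝ Φ q v) (x, t) w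
      = fderiv ℝ (fderiv ℝ Φ) (x, t) w v := by
    intro v w
    rw [fderiv_clm_apply hd (differentiableAt_const _)]
    simp
  have hev : ∀ᶠ q in nhds (x, t), q ∈ {q : E3 × ℝ | 1 < q.2} := isOpen_after.mem_nhds ht
  rw [(hf.pd i).deriv_time_eq x ht]
  unfold _root_.pd
  rw [hf.deriv_time.fderiv_space_eq x ht]
  have h1 : (fun q : E3 × ℝ => fderiv ℝ (fun y => f y q.2) q.1 (EuclideanSpace.single i 1))
      =ᶠ[nhds (x, t)] fun q => fderiv ℝ Φ q (EuclideanSpace.single i 1, 0) :=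
    hev.mono fun q hq => hf.fderiv_space_eq q.1 hq _
  have h2 : (fun q : E3 × ℝ => deriv (f q.1) q.2) =ᶠ[nhds (x, t)] fun q => fderiv ℝ Φ q (0, 1) :=
    hev.mono fun q hq => hf.deriv_time_eq q.1 hq
  rw [h1.fderiv_eq, h2.fderiv_eq, key, key]
  exact ((hf.contDiffAt x ht).isSymmSndFDerivAt (by simp; norm_cast)) _ _

theorem iterPd {f : E3 → ℝ → ℝ} (hf : SmoothAfter f) (l : List (Fin 3)) :
    SmoothAfter (fun x t => iterPd l (fun y => f y t) x) := by
  induction l with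
  | nil => exact hf
  | cons i l ih => exact ih.pd i

theorem deriv_iterPd {f : E3 → ℝ → ℝ} (hf : SmoothAfter f) (l : List (Fin 3)) (x : E3) {t : ℝ}
    (ht : 1 < t) :
    deriv (fun s => _root_.iterPd l (fun y => f y s) x) t
      = _root_.iterPd l (fun y => deriv (f y) t) x := by
  induction l generalizing x with
  | nil => rfl
  | cons i l ih =>
    refine ((hf.iterPd l).deriv_pd i x ht).trans ?_
    simp only [ih, _root_.iterPd]

end SmoothAfter

/-- The integrable weight `(1 + ‖x‖)⁻⁴`. -/
def decayWeight (x : E3) : ℝ := ((1 + ‖x‖) ^ 4)⁻¹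

theorem decayWeight_pos (x : E3) : 0 < decayWeight x := by
  unfold decayWeight; positivity

theorem decayWeight_le_one (x : E3) : decayWeight x ≤ 1 :=
  inv_le_one_of_one_le₀ (one_le_pow₀ (by linarith [norm_nonneg x]))

theorem integrable_decayWeight : Integrable decayWeight (volume : Measure E3) := by
  have h := integrable_one_add_norm (E := E3) (μ := volume) (r := 4) (by simp; norm_num)
  refine h.congr (Filter.Eventually.of_forall fun x => ?_)
  have : (0 : ℝ) ≤ 1 + ‖x‖ := by positivity
  simp only [decayWeight]
  rw [Real.rpow_neg this]
  norm_cast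

theorem integrable_of_abs_le_decayWeight {f : E3 → ℝ} (hf : Continuous f) {C : ℝ}
    (h : ∀ x, |f x| ≤ C * decayWeight x) : Integrable f :=
  (integrable_decayWeight.const_mul C).mono' hf.aestronglyMeasurable
    (Filter.Eventually.of_forall h)

theorem abs_mul_le_decayWeight {a b C D : ℝ} {x : E3} (ha : |a| ≤ C * decayWeight x)
    (hb : |b| ≤ D * decayWeight x) (hD : 0 ≤ D) : |a * b| ≤ C * D * decayWeight x := by
  have hb' : |b| ≤ D := hb.trans (mul_le_of_le_one_right hD (decayWeight_le_one x))
  rw [abs_mul]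
  calc |a| * |b| ≤ C * decayWeight x * D :=
        mul_le_mul ha hb' (abs_nonneg _) ((abs_nonneg _).trans ha)
    _ = C * D * decayWeight x := by ring

theorem sobSq_nonneg (m : ℕ) (g : E3 → ℝ) : 0 ≤ sobSq m g :=
  Finset.sum_nonneg fun _ _ => integral_nonneg fun _ => sq_nonneg _

/-- Sum over `i` of the energies of `∂ᵢ∂ˡθ`. -/
def gradEnergy (θ : E3 → ℝ → ℝ) (l : List (Fin 3)) (t : ℝ) : ℝ :=
  ∑ i, ∫ x, iterPd (i :: l) (fun y => θ y t) x ^ 2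

theorem gradEnergy_nonneg (θ : E3 → ℝ → ℝ) (l : List (Fin 3)) (t : ℝ) : 0 ≤ gradEnergy θ l t :=
  Finset.sum_nonneg fun _ _ => integral_nonneg fun _ => sq_nonneg _

namespace IsAdmissible

variable {U : E3 → E3} {θ : E3 → ℝ → ℝ}

theorem smoothAfter (h : IsAdmissible U θ) : SmoothAfter θ :=
  h.1.mono fun q (hq : 1 < q.2) => show 1 ≤ q.2 from hq.le

theorem exists_norm_iteratedFDeriv_le (h : IsAdmissible U θ) (j : ℕ) (T : ℝ) :
    ∃ C : ℝ, 0 ≤ C ∧ ∀ (x : E3) (t : ℝ), 1 ≤ t → t ≤ T →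
      ‖iteratedFDeriv ℝ j (fun y => θ y t) x‖ ≤ C * decayWeight x := by
  obtain ⟨C₀, h₀⟩ := h.2.2 0 j T
  obtain ⟨C₄, h₄⟩ := h.2.2 4 j T
  refine ⟨8 * (|C₀| + |C₄|), by positivity, fun x t ht hT => ?_⟩
  have h0 := (h₀ x t ht hT).trans (le_abs_self _)
  have h4 := (h₄ x t ht hT).trans (le_abs_self _)
  set a := ‖iteratedFDeriv ℝ j (fun y => θ y t) x‖ with ha
  have ha0 : 0 ≤ a := norm_nonneg _
  have hp : (1 + ‖x‖) ^ 4 ≤ 8 * (1 + ‖x‖ ^ 4) := by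
    nlinarith [sq_nonneg (‖x‖ - 1), sq_nonneg (‖x‖ ^ 2 - 1), sq_nonneg (‖x‖ ^ 2 - ‖x‖),
      norm_nonneg x]
  unfold decayWeight
  rw [← div_eq_mul_inv, le_div_iff₀ (by positivity)]
  nlinarith [mul_le_mul_of_nonneg_left hp ha0]

theorem exists_abs_iterPd_le (h : IsAdmissible U θ) (l : List (Fin 3)) (T : ℝ) :
    ∃ C : ℝ, 0 ≤ C ∧ ∀ (x : E3) (t : ℝ), 1 < t → t ≤ T →
      |iterPd l (fun y => θ y t) x| ≤ C * decayWeight x := by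
  obtain ⟨C, hC0, hC⟩ := h.exists_norm_iteratedFDeriv_le l.length T
  exact ⟨C, hC0, fun x t ht hT =>
    (abs_iterPd_le (h.smoothAfter.contDiff_space ht) l x).trans (hC x t ht.le hT)⟩

theorem deriv_iterPd_eq (hU : ContDiff ℝ (⊤ : ℕ∞) U) (h : IsAdmissible U θ) (l : List (Fin 3))
    (x : E3) {t : ℝ} (ht : 1 < t) :
    deriv (fun s => iterPd l (fun y => θ y s) x) t
      = lap (iterPd l (fun y => θ y t)) x
        - iterPd l (advection (fun y => ubar U y t) (fun y => θ y t)) x := by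
  have hs := h.smoothAfter.contDiff_space ht
  rw [h.smoothAfter.deriv_iterPd l x ht, ← iterPd_lap hs]
  have he : (fun y => deriv (θ y) t) = fun y => lap (fun y => θ y t) y
      - advection (fun y => ubar U y t) (fun y => θ y t) y :=
    funext fun y => h.2.1 y t ht.le
  rw [he, iterPd_sub (contDiff_lap hs) (contDiff_advection (contDiff_ubar hU t) hs)]

theorem exists_abs_lap_iterPd_le (h : IsAdmissible U θ) (l : List (Fin 3)) (T : ℝ) :
    ∃ C : ℝ, 0 ≤ C ∧ ∀ (x : E3) (t : ℝ), 1 < t → t ≤ T →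
      |lap (iterPd l (fun y => θ y t)) x| ≤ C * decayWeight x := by
  choose C hC0 hC using fun i : Fin 3 => h.exists_abs_iterPd_le (i :: i :: l) T
  refine ⟨∑ i, C i, Finset.sum_nonneg fun i _ => hC0 i, fun x t ht hT => ?_⟩
  rw [Finset.sum_mul]
  exact (Finset.abs_sum_le_sum_abs _ _).trans (Finset.sum_le_sum fun i _ => hC i x t ht hT)

theorem exists_abs_deriv_iterPd_le (hU : ContDiff ℝ (⊤ : ℕ∞) U) (hUc : HasCompactSupport U)
    (h : IsAdmissible U θ) (l : List (Fin 3)) (T : ℝ) :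
    ∃ C : ℝ, 0 ≤ C ∧ ∀ (x : E3) (t : ℝ), 1 < t → t ≤ T →
      |deriv (fun s => iterPd l (fun y => θ y s) x) t| ≤ C * decayWeight x := by
  obtain ⟨C, hC0, hC⟩ := h.exists_abs_lap_iterPd_le l T
  obtain ⟨M, hM0, hM⟩ := exists_norm_iteratedFDeriv_advection_le hU hUc l.length
  choose D hD0 hD using fun j : ℕ => h.exists_norm_iteratedFDeriv_le j T
  refine ⟨C + M * ∑ j ∈ Finset.range (l.length + 2), D j,
    add_nonneg hC0 (mul_nonneg hM0 (Finset.sum_nonneg fun j _ => hD0 j)), fun x t ht hT => ?_⟩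
  have hs := h.smoothAfter.contDiff_space ht
  rw [h.deriv_iterPd_eq hU l x ht, add_mul]
  refine (abs_sub _ _).trans (add_le_add (hC x t ht hT) ?_)
  refine (abs_iterPd_le (contDiff_advection (contDiff_ubar hU t) hs) l x).trans ?_
  refine (hM t ht.le _ hs x).trans ?_
  have hc0 : 0 ≤ t ^ (-(1:ℝ)/2) := Real.rpow_nonneg (by linarith) _
  have hc1 : t ^ (-(1:ℝ)/2) ≤ 1 := Real.rpow_le_one_of_one_le_of_nonpos ht.le (by norm_num)
  rw [mul_assoc M (∑ j ∈ Finset.range (l.length + 2), D j), Finset.sum_mul]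
  refine mul_le_mul (mul_le_of_le_one_right hM0 hc1)
    (Finset.sum_le_sum fun j _ => hD j x t ht.le hT)
    (Finset.sum_nonneg fun j _ => norm_nonneg _) hM0

theorem integrable_norm_iteratedFDeriv_sq (h : IsAdmissible U θ) (j : ℕ) {t : ℝ} (ht : 1 < t) :
    Integrable fun x => ‖iteratedFDeriv ℝ j (fun y => θ y t) x‖ ^ 2 := by
  obtain ⟨C, hC0, hC⟩ := h.exists_norm_iteratedFDeriv_le j t
  have hc : Continuous fun x => iteratedFDeriv ℝ j (fun y => θ y t) x :=
    (h.smoothAfter.contDiff_space ht).continuous_iteratedFDeriv (by exact_mod_cast le_top)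
  refine integrable_of_abs_le_decayWeight (hc.norm.pow 2) (C := C * C) fun x => ?_
  rw [sq]
  have := hC x t ht.le le_rfl
  exact abs_mul_le_decayWeight (by rwa [abs_norm]) (by rwa [abs_norm]) hC0

theorem integrable_iterPd_sq (h : IsAdmissible U θ) (l : List (Fin 3)) {t : ℝ} (ht : 1 < t) :
    Integrable fun x => iterPd l (fun y => θ y t) x ^ 2 := by
  obtain ⟨C, hC0, hC⟩ := h.exists_abs_iterPd_le l t
  have hc := (contDiff_iterPd (h.smoothAfter.contDiff_space ht) l).continuous
  refine integrable_of_abs_le_decayWeight (hc.pow 2) (C := C * C) fun x => ?_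
  rw [sq]
  exact abs_mul_le_decayWeight (hC x t ht le_rfl) (hC x t ht le_rfl) hC0

theorem hasDerivAt_integral_iterPd_sq (hU : ContDiff ℝ (⊤ : ℕ∞) U) (hUc : HasCompactSupport U)
    (h : IsAdmissible U θ) (l : List (Fin 3)) {t : ℝ} (ht : 1 < t) :
    HasDerivAt (fun s => ∫ x, iterPd l (fun y => θ y s) x ^ 2)
      (∫ x, 2 * (iterPd l (fun y => θ y t) x
        * deriv (fun s => iterPd l (fun y => θ y s) x) t)) t := by
  obtain ⟨C, hC0, hC⟩ := h.exists_abs_iterPd_le l (t + 1)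
  obtain ⟨D, hD0, hD⟩ := h.exists_abs_deriv_iterPd_le hU hUc l (t + 1)
  have hl := h.smoothAfter.iterPd l
  have hcont : ∀ s : ℝ, 1 < s → Continuous fun x => iterPd l (fun y => θ y s) x :=
    fun s hs => (hl.contDiff_space hs).continuous
  have hmem : Set.Ioo 1 (t + 1) ∈ nhds t := Ioo_mem_nhds ht (by linarith)
  refine (hasDerivAt_integral_of_dominated_loc_of_deriv_le (μ := volume)
    (F := fun s x => iterPd l (fun y => θ y s) x ^ 2)
    (F' := fun s x => 2 * (iterPd l (fun y => θ y s) x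
        * deriv (fun s => iterPd l (fun y => θ y s) x) s))
    (bound := fun x => 2 * (C * D * decayWeight x)) hmem ?_ (h.integrable_iterPd_sq l ht) ?_ ?_
    ((integrable_decayWeight.const_mul _).const_mul _) ?_).2
  · filter_upwards [hmem] with s hs
    exact ((hcont s hs.1).pow 2).aestronglyMeasurable
  · exact (continuous_const.mul ((hcont t ht).mul
      (hl.deriv_time.contDiff_space ht).continuous)).aestronglyMeasurable
  · refine Filter.Eventually.of_forall fun x s hs => ?_
    rw [norm_mul, Real.norm_ofNat]
    gcongr
    exact abs_mul_le_decayWeight (hC x s hs.1 hs.2.le) (hD x s hs.1 hs.2.le) hD0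
  · refine Filter.Eventually.of_forall fun x s hs => ?_
    refine ((hl.hasDerivAt_time x hs.1).pow 2).congr_deriv ?_
    push_cast
    ring

theorem integral_pd_mul_deriv_eq (hU : ContDiff ℝ (⊤ : ℕ∞) U) (hUc : HasCompactSupport U)
    (h : IsAdmissible U θ) (l : List (Fin 3)) (i : Fin 3) {t : ℝ} (ht : 1 < t) :
    ∫ x, iterPd (i :: l) (fun y => θ y t) x
        * deriv (fun s => iterPd (i :: l) (fun y => θ y s) x) t
      = -∫ x, iterPd (i :: i :: l) (fun y => θ y t) x
        * deriv (fun s => iterPd l (fun y => θ y s) x) t := by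
  obtain ⟨C₁, -, hC₁⟩ := h.exists_abs_iterPd_le (i :: l) t
  obtain ⟨C₂, -, hC₂⟩ := h.exists_abs_iterPd_le (i :: i :: l) t
  obtain ⟨D₀, hD₀0, hD₀⟩ := h.exists_abs_deriv_iterPd_le hU hUc l t
  obtain ⟨D₁, hD₁0, hD₁⟩ := h.exists_abs_deriv_iterPd_le hU hUc (i :: l) t
  have hs := h.smoothAfter.contDiff_space ht
  have h₁ := contDiff_iterPd hs (i :: l)
  have h₂ := contDiff_iterPd hs (i :: i :: l)
  have hg₀ := (h.smoothAfter.iterPd l).deriv_time.contDiff_space ht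
  have hg₁ := (h.smoothAfter.iterPd (i :: l)).deriv_time.contDiff_space ht
  have hg : ∀ x, deriv (fun s => iterPd (i :: l) (fun y => θ y s) x) t
      = fderiv ℝ (fun y => deriv (fun s => iterPd l (fun y => θ y s) y) t) x
        (EuclideanSpace.single i 1) := fun x => (h.smoothAfter.iterPd l).deriv_pd i x ht
  have hi₁ : Integrable fun x => iterPd (i :: l) (fun y => θ y t) x
      * deriv (fun s => iterPd (i :: l) (fun y => θ y s) x) t :=
    integrable_of_abs_le_decayWeight (h₁.continuous.mul hg₁.continuous) fun x =>
      abs_mul_le_decayWeight (hC₁ x t ht le_rfl) (hD₁ x t ht le_rfl) hD₁0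
  simp only [hg] at hi₁ ⊢
  exact integral_mul_fderiv_eq_neg_fderiv_mul_of_integrable
    (integrable_of_abs_le_decayWeight (h₂.continuous.mul hg₀.continuous) fun x =>
      abs_mul_le_decayWeight (hC₂ x t ht le_rfl) (hD₀ x t ht le_rfl) hD₀0) hi₁
    (integrable_of_abs_le_decayWeight (h₁.continuous.mul hg₀.continuous) fun x =>
      abs_mul_le_decayWeight (hC₁ x t ht le_rfl) (hD₀ x t ht le_rfl) hD₀0)
    (fun x _ => h₁.differentiable (by simp) x) (fun x _ => hg₀.differentiable (by simp) x)

theorem continuousAt_sobSq (h : IsAdmissible U θ) (m : ℕ) {t : ℝ} (ht : 1 < t) :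
    ContinuousAt (fun s => sobSq m (fun x => θ x s)) t := by
  have hmem : Set.Ioo 1 (t + 1) ∈ nhds t := Ioo_mem_nhds ht (by linarith)
  refine tendsto_finsetSum _ fun j _ => ?_
  obtain ⟨C, hC0, hC⟩ := h.exists_norm_iteratedFDeriv_le j (t + 1)
  refine MeasureTheory.continuousAt_of_dominated
    (F := fun s x => ‖iteratedFDeriv ℝ j (fun y => θ y s) x‖ ^ 2)
    (bound := fun x => C * C * decayWeight x) ?_ ?_ (integrable_decayWeight.const_mul _) ?_
  · filter_upwards [hmem] with s hs
    exact (h.integrable_norm_iteratedFDeriv_sq j hs.1).aestronglyMeasurable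
  · filter_upwards [hmem] with s hs
    refine Filter.Eventually.of_forall fun x => ?_
    have := hC x s hs.1.le hs.2.le
    rw [sq]
    exact abs_mul_le_decayWeight (by rwa [abs_norm]) (by rwa [abs_norm]) hC0
  · exact Filter.Eventually.of_forall fun x =>
      (((h.smoothAfter.iteratedFDeriv_space j).contDiffAt_time x ht).continuousAt.norm.pow 2)

theorem exists_sobSq_le (h : IsAdmissible U θ) (m : ℕ) (T : ℝ) :
    ∃ B : ℝ, 0 ≤ B ∧ ∀ t : ℝ, 1 < t → t ≤ T → sobSq m (fun x => θ x t) ≤ B := by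
  choose C hC0 hC using fun j : ℕ => h.exists_norm_iteratedFDeriv_le j T
  refine ⟨∑ j ∈ Finset.range (m + 1), ∫ x, C j * C j * decayWeight x,
    Finset.sum_nonneg fun j _ => integral_nonneg fun x =>
      mul_nonneg (mul_self_nonneg _) (decayWeight_pos x).le,
    fun t ht hT => Finset.sum_le_sum fun j _ => ?_⟩
  refine integral_mono (h.integrable_norm_iteratedFDeriv_sq j ht)
    (integrable_decayWeight.const_mul _) fun x => ?_
  have := hC j x t ht.le hT
  refine (le_abs_self _).trans ?_
  rw [sq]
  exact abs_mul_le_decayWeight (by rwa [abs_norm]) (by rwa [abs_norm]) (hC0 j)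

theorem integrableOn_sobSq (h : IsAdmissible U θ) (m : ℕ) (t : ℝ) :
    IntegrableOn (fun s => sobSq m (fun x => θ x s)) (Set.Icc 1 t) := by
  obtain ⟨B, -, hB⟩ := h.exists_sobSq_le m t
  rw [integrableOn_Icc_iff_integrableOn_Ioc]
  have hc : ContinuousOn (fun s => sobSq m (fun x => θ x s)) (Set.Ioc 1 t) :=
    fun s hs => (h.continuousAt_sobSq m hs.1).continuousWithinAt
  refine (integrableOn_const (C := B) (by simp)).mono'
    (hc.aestronglyMeasurable measurableSet_Ioc) ?_
  filter_upwards [ae_restrict_mem measurableSet_Ioc] with s hs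
  rw [Real.norm_of_nonneg (sobSq_nonneg _ _)]
  exact hB s hs.1 hs.2

theorem integral_iterPd_sq_le_sobSq (h : IsAdmissible U θ) (l : List (Fin 3)) {t : ℝ}
    (ht : 1 < t) :
    ∫ x, iterPd l (fun y => θ y t) x ^ 2 ≤ sobSq l.length (fun x => θ x t) := by
  refine (integral_mono (h.integrable_iterPd_sq l ht)
    (h.integrable_norm_iteratedFDeriv_sq l.length ht) fun x => ?_).trans
    (Finset.single_le_sum (f := fun j => ∫ x, ‖iteratedFDeriv ℝ j (fun y => θ y t) x‖ ^ 2)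
      (fun _ _ => integral_nonneg fun _ => sq_nonneg _) (Finset.self_mem_range_succ _))
  simp only
  rw [← sq_abs]
  gcongr
  exact abs_iterPd_le (h.smoothAfter.contDiff_space ht) l x

theorem gradEnergy_le (h : IsAdmissible U θ) (l : List (Fin 3)) {t : ℝ} (ht : 1 < t) :
    gradEnergy θ l t ≤ 3 * sobSq (l.length + 1) (fun x => θ x t) := by
  refine (Finset.sum_le_sum fun i _ => h.integral_iterPd_sq_le_sobSq (i :: l) ht).trans ?_
  simp

theorem exists_hasDerivAt_gradEnergy (hU : ContDiff ℝ (⊤ : ℕ∞) U) (hUc : HasCompactSupport U)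
    (l : List (Fin 3)) :
    ∃ K : ℝ, 0 ≤ K ∧ ∀ θ : E3 → ℝ → ℝ, IsAdmissible U θ → ∀ t : ℝ, 1 < t →
      ∃ E' : ℝ, HasDerivAt (gradEnergy θ l) E' t ∧
        E' ≤ K * t⁻¹ * sobSq (l.length + 1) (fun x => θ x t) := by
  obtain ⟨M, hM0, hM⟩ := exists_norm_iteratedFDeriv_advection_le hU hUc l.length
  refine ⟨M ^ 2 * (l.length + 2), by positivity, fun θ h t ht => ?_⟩
  refine ⟨_, HasDerivAt.fun_sum fun i _ => h.hasDerivAt_integral_iterPd_sq hU hUc (i :: l) ht, ?_⟩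
  have hs := h.smoothAfter.contDiff_space ht
  set g : E3 → ℝ := fun x => deriv (fun s => iterPd l (fun y => θ y s) x) t with hg
  have hgc : Continuous g := ((h.smoothAfter.iterPd l).deriv_time.contDiff_space ht).continuous
  obtain ⟨D, hD0, hD⟩ := h.exists_abs_deriv_iterPd_le hU hUc l t
  have hint : ∀ i : Fin 3, Integrable fun x => iterPd (i :: i :: l) (fun y => θ y t) x * g x := by
    intro i
    obtain ⟨C, -, hC⟩ := h.exists_abs_iterPd_le (i :: i :: l) t
    exact integrable_of_abs_le_decayWeight
      ((contDiff_iterPd hs (i :: i :: l)).continuous.mul hgc) fun x =>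
      abs_mul_le_decayWeight (hC x t ht le_rfl) (hD x t ht le_rfl) hD0
  have hsum : ∑ i, ∫ x, 2 * (iterPd (i :: l) (fun y => θ y t) x
        * deriv (fun s => iterPd (i :: l) (fun y => θ y s) x) t)
      = ∫ x, -2 * (lap (iterPd l (fun y => θ y t)) x * g x) := by
    simp only [integral_const_mul, h.integral_pd_mul_deriv_eq hU hUc l _ ht]
    rw [← Finset.mul_sum, Finset.sum_neg_distrib, ← integral_finsetSum _ fun i _ => hint i]
    simp only [← Finset.sum_mul]
    rw [mul_neg, neg_mul]
    rfl
  rw [hsum]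
  have hint' : Integrable fun x => -2 * (lap (iterPd l (fun y => θ y t)) x * g x) := by
    refine Integrable.const_mul ?_ _
    refine (integrable_finsetSum Finset.univ fun i _ => hint i).congr
      (Filter.Eventually.of_forall fun x => ?_)
    simp only [← Finset.sum_mul]
    rfl
  have hN : ∀ j ∈ Finset.range (l.length + 2),
      Integrable fun x => ‖iteratedFDeriv ℝ j (fun y => θ y t) x‖ ^ 2 :=
    fun j _ => h.integrable_norm_iteratedFDeriv_sq j ht
  have hS : sobSq (l.length + 1) (fun x => θ x t)
      = ∫ x, ∑ j ∈ Finset.range (l.length + 2), ‖iteratedFDeriv ℝ j (fun y => θ y t) x‖ ^ 2 :=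
    (integral_finsetSum _ hN).symm
  rw [hS, ← integral_const_mul]
  refine integral_mono hint' ((integrable_finsetSum _ hN).const_mul _) fun x => ?_
  simp only
  have hgx : g x = lap (iterPd l (fun y => θ y t)) x
      - iterPd l (advection (fun y => ubar U y t) (fun y => θ y t)) x :=
    h.deriv_iterPd_eq hU l x ht
  rw [hgx]
  have hb := (abs_iterPd_le (contDiff_advection (contDiff_ubar hU t) hs) l x).trans
    (hM t ht.le _ hs x)
  set L := lap (iterPd l (fun y => θ y t)) x
  set b := iterPd l (advection (fun y => ubar U y t) (fun y => θ y t)) x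
  set c : ℝ := t ^ (-(1:ℝ)/2) with hc
  have hcc : c ^ 2 = t⁻¹ := by
    rw [hc, ← Real.rpow_natCast, ← Real.rpow_mul (by linarith), ← Real.rpow_neg_one]
    norm_num
  have hcs := sq_sum_le_card_mul_sum_sq (s := Finset.range (l.length + 2))
    (f := fun j => ‖iteratedFDeriv ℝ j (fun y => θ y t) x‖)
  rw [Finset.card_range] at hcs
  push_cast at hcs
  calc -2 * (L * (L - b)) ≤ b ^ 2 := by nlinarith [sq_nonneg (L - b), sq_nonneg L]
    _ ≤ (M * c * ∑ j ∈ Finset.range (l.length + 2),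
          ‖iteratedFDeriv ℝ j (fun y => θ y t) x‖) ^ 2 := by
        rw [← sq_abs]
        gcongr
    _ = M ^ 2 * t⁻¹ * (∑ j ∈ Finset.range (l.length + 2),
          ‖iteratedFDeriv ℝ j (fun y => θ y t) x‖) ^ 2 := by rw [mul_pow, mul_pow, hcc]
    _ ≤ M ^ 2 * t⁻¹ * ((l.length + 2) * ∑ j ∈ Finset.range (l.length + 2),
          ‖iteratedFDeriv ℝ j (fun y => θ y t) x‖ ^ 2) := by
        have : 0 < t := by linarith
        gcongr
    _ = _ := by ring

theorem exists_weighted_gradEnergy_le (hU : ContDiff ℝ (⊤ : ℕ∞) U) (hUc : HasCompactSupport U)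
    (l : List (Fin 3)) :
    ∃ K : ℝ, 0 ≤ K ∧ ∀ θ : E3 → ℝ → ℝ, IsAdmissible U θ → ∀ t : ℝ, 1 < t →
      (t - 1) * gradEnergy θ l t
        ≤ K * ∫ s in (1:ℝ)..t, sobSq (l.length + 1) (fun x => θ x s) := by
  obtain ⟨K, hK0, hK⟩ := exists_hasDerivAt_gradEnergy hU hUc l
  refine ⟨3 + K, by positivity, fun θ h t ht => ?_⟩
  choose! E' hE' hE'le using hK θ h
  obtain ⟨B, hB0, hB⟩ := h.exists_sobSq_le (l.length + 1) t
  have hderiv : ∀ s : ℝ, 1 < s → HasDerivAt (fun s => (s - 1) * gradEnergy θ l s)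
      (1 * gradEnergy θ l s + (s - 1) * E' s) s := fun s hs =>
    ((hasDerivAt_id s).sub_const 1).mul (hE' s hs)
  have hcont : ContinuousOn (fun s => (s - 1) * gradEnergy θ l s) (Set.Icc 1 t) := by
    intro s hs
    rcases hs.1.eq_or_lt with rfl | h1
    · rw [ContinuousWithinAt, sub_self, zero_mul]
      have hlim : Filter.Tendsto (fun s : ℝ => (s - 1) * (3 * B)) (nhdsWithin 1 (Set.Icc 1 t))
          (nhds 0) := by
        have : Continuous fun s : ℝ => (s - 1) * (3 * B) := by fun_prop
        simpa using (this.tendsto 1).mono_left nhdsWithin_le_nhds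
      refine squeeze_zero' ?_ ?_ hlim
      · filter_upwards [self_mem_nhdsWithin] with s hs
        exact mul_nonneg (sub_nonneg.2 hs.1) (gradEnergy_nonneg θ l s)
      · filter_upwards [self_mem_nhdsWithin] with s hs
        rcases hs.1.eq_or_lt with rfl | h1
        · simp
        · have := sub_nonneg.2 hs.1
          gcongr
          exact (h.gradEnergy_le l h1).trans (by linarith [hB s h1 hs.2])
    · exact (hderiv s h1).continuousAt.continuousWithinAt
  have hle := intervalIntegral.sub_le_integral_of_hasDeriv_right_of_le ht.le hcont
    (fun s hs => (hderiv s hs.1).hasDerivWithinAt)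
    ((h.integrableOn_sobSq (l.length + 1) t).const_mul (3 + K)) fun s hs => by
      have h0 : 0 ≤ sobSq (l.length + 1) (fun x => θ x s) := sobSq_nonneg _ _
      have h1 := h.gradEnergy_le l hs.1
      have hs0 : 0 < s := by linarith [hs.1]
      have h2 : (s - 1) * E' s ≤ K * sobSq (l.length + 1) (fun x => θ x s) :=
        calc (s - 1) * E' s
            ≤ (s - 1) * (K * s⁻¹ * sobSq (l.length + 1) (fun x => θ x s)) :=
              mul_le_mul_of_nonneg_left (hE'le s hs.1) (by linarith [hs.1])
          _ = ((s - 1) * s⁻¹) * (K * sobSq (l.length + 1) (fun x => θ x s)) := by ring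
          _ ≤ 1 * (K * sobSq (l.length + 1) (fun x => θ x s)) := by
              gcongr
              rw [← div_eq_mul_inv, div_le_one hs0]
              linarith
          _ = _ := one_mul _
      linarith
  simpa only [sub_self, zero_mul, sub_zero, intervalIntegral.integral_const_mul] using hle

theorem integral_norm_iteratedFDeriv_sq_le (h : IsAdmissible U θ) (n : ℕ) {t : ℝ} (ht : 1 < t) :
    ∫ x, ‖iteratedFDeriv ℝ n (fun y => θ y t) x‖ ^ 2
      ≤ 3 ^ n * ∑ α : Fin n → Fin 3, ∫ x, iterPd (List.ofFn α) (fun y => θ y t) x ^ 2 := by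
  have hi : ∀ α ∈ (Finset.univ : Finset (Fin n → Fin 3)),
      Integrable fun x => iterPd (List.ofFn α) (fun y => θ y t) x ^ 2 :=
    fun α _ => h.integrable_iterPd_sq _ ht
  rw [← integral_finsetSum _ hi, ← integral_const_mul]
  refine integral_mono (h.integrable_norm_iteratedFDeriv_sq n ht)
    ((integrable_finsetSum _ hi).const_mul _) fun x => ?_
  have hcs := sq_sum_le_card_mul_sum_sq (s := (Finset.univ : Finset (Fin n → Fin 3)))
    (f := fun α => |iterPd (List.ofFn α) (fun y => θ y t) x|)
  simp only [sq_abs, Finset.card_univ, Fintype.card_pi, Fintype.card_fin, Finset.prod_const] at hcs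
  push_cast at hcs
  refine (pow_le_pow_left₀ (norm_nonneg _) (norm_iteratedFDeriv_le_sum_iterPd
    (h.smoothAfter.contDiff_space ht) n x) 2).trans hcs

end IsAdmissible

/-- **Weighted derivative estimate for the advected heat equation.**  For every integer
`k ≥ 1` there is `C = C(k, Ū)` such that any admissible solution of `∂ₜθ = Δθ − ū·∇θ`
on `[1,∞)` satisfies `(t−1)^k ‖∇^kθ(t)‖² ≤ C (t−1)^{k−1} ∫₁ᵗ ‖θ(s)‖²_{H^k} ds`
for all `t > 1`. -/
theorem advected_heat_weighted_estimate
    (Ubar : E3 → E3) (hU : ContDiff ℝ (⊤ : ℕ∞) Ubar) (hUc : HasCompactSupport Ubar)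
    (hUdiv : ∀ x, divg Ubar x = 0) :
    ∀ k : ℕ, 1 ≤ k → ∃ C : ℝ,
      ∀ θ : E3 → ℝ → ℝ, IsAdmissible Ubar θ →
        ∀ t : ℝ, 1 < t →
          (t - 1) ^ k * (∫ x : E3, ‖iteratedFDeriv ℝ k (fun y => θ y t) x‖ ^ 2)
            ≤ C * (t - 1) ^ (k - 1) * ∫ s in (1:ℝ)..t, sobSq k (fun x => θ x s) := by
  intro k hk
  obtain ⟨m, rfl⟩ : ∃ m, k = m + 1 := ⟨k - 1, by omega⟩
  choose K hK0 hK using fun l : List (Fin 3) =>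
    IsAdmissible.exists_weighted_gradEnergy_le hU hUc l
  refine ⟨3 ^ (m + 1) * ∑ α : Fin (m + 1) → Fin 3, K (List.ofFn fun r => α r.succ),
    fun θ h t ht => ?_⟩
  have ht0 : 0 ≤ t - 1 := by linarith
  have hα : ∀ α : Fin (m + 1) → Fin 3,
      (t - 1) * ∫ x, iterPd (List.ofFn α) (fun y => θ y t) x ^ 2
        ≤ K (List.ofFn fun r => α r.succ)
          * ∫ s in (1:ℝ)..t, sobSq (m + 1) (fun x => θ x s) := by
    intro α
    have hE := hK (List.ofFn fun r => α r.succ) θ h t ht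
    rw [List.length_ofFn] at hE
    refine le_trans (mul_le_mul_of_nonneg_left ?_ ht0) hE
    rw [List.ofFn_succ]
    exact Finset.single_le_sum
      (f := fun i => ∫ x, iterPd (i :: List.ofFn fun r => α r.succ) (fun y => θ y t) x ^ 2)
      (fun _ _ => integral_nonneg fun _ => sq_nonneg _) (Finset.mem_univ (α 0))
  rw [Nat.add_sub_cancel]
  calc (t - 1) ^ (m + 1) * ∫ x, ‖iteratedFDeriv ℝ (m + 1) (fun y => θ y t) x‖ ^ 2
      ≤ (t - 1) ^ (m + 1) * (3 ^ (m + 1) * ∑ α : Fin (m + 1) → Fin 3,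
          ∫ x, iterPd (List.ofFn α) (fun y => θ y t) x ^ 2) := by
        gcongr
        exact h.integral_norm_iteratedFDeriv_sq_le (m + 1) ht
    _ = 3 ^ (m + 1) * (t - 1) ^ m * ∑ α : Fin (m + 1) → Fin 3,
          (t - 1) * ∫ x, iterPd (List.ofFn α) (fun y => θ y t) x ^ 2 := by
        rw [← Finset.mul_sum]
        ring
    _ ≤ 3 ^ (m + 1) * (t - 1) ^ m * ∑ α : Fin (m + 1) → Fin 3,
          K (List.ofFn fun r => α r.succ)
            * ∫ s in (1:ℝ)..t, sobSq (m + 1) (fun x => θ x s) := by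
        exact mul_le_mul_of_nonneg_left (Finset.sum_le_sum fun α _ => hα α) (by positivity)
    _ = _ := by
        rw [← Finset.sum_mul]
        ring
end
end

section
/- Let Ū ∈ C_c^∞(ℝ³;ℝ³) be divergence-free, let Θ̄ ∈ C_c^∞(ℝ³;ℝ) have compact support contained in ℝ³∖{0}, and let b ≥ 0. For t > 0 define ū(x,t) := t^{-1/2}·Ū(x/√t), θ̄(x,t) := t^{b−1/2}·Θ̄(x/√t), f := ∂ₜū + (ū·∇)ū − Δū − θ̄·x/|x|³, and h := ∂ₜθ̄ + ū·∇θ̄ − Δθ̄ (so that (u,p,θ) = (ū, 0, θ̄) solves the Oberbeck–Boussinesq system with force f and heat source h). Then there exists a constant C = C(Ū, Θ̄, b) such that for all 0 < t ≤ 1: ‖f(·,t)‖_{L²(ℝ³)} + ‖h(·,t)‖_{L²(ℝ³)} ≤ C·t^{−3/4}; consequently t ↦ ‖f(·,t)‖_{L²} and t ↦ ‖h(·,t)‖_{L²} are integrable on (0,1). -/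
noncomputable section

open MeasureTheory
open scoped ENNReal BigOperators

/-- The self-similar temperature profile `θ̄(x,t) = t^{b−1/2} Θ̄(x/√t)`
(equal to `e^{bτ} Θ̄(ξ)` in self-similar variables `ξ = x/√t`, `τ = log t`). -/
noncomputable def thetabar (Tbar : E3 → ℝ) (b : ℝ) (x : E3) (t : ℝ) : ℝ :=
  (t ^ (b - 1/2)) * Tbar ((t ^ (-(1:ℝ)/2)) • x)

/-- The external force `f = ∂ₜū + (ū·∇)ū − Δū − θ̄·x/|x|³` making `(ū, 0, θ̄)` an exact
solution of the Oberbeck–Boussinesq momentum equation (`j`-th component). -/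
noncomputable def forceF (Ubar : E3 → E3) (Tbar : E3 → ℝ) (b : ℝ)
    (x : E3) (t : ℝ) (j : Fin 3) : ℝ :=
  deriv (fun s => ubar Ubar x s j) t
    + (∑ i, ubar Ubar x t i * pd (fun y => ubar Ubar y t j) i x)
    - lap (fun y => ubar Ubar y t j) x
    - thetabar Tbar b x t * (x j / ‖x‖ ^ 3)

/-- The heat source `h = ∂ₜθ̄ + ū·∇θ̄ − Δθ̄` making `θ̄` an exact solution of the
temperature equation. -/
noncomputable def sourceH (Ubar : E3 → E3) (Tbar : E3 → ℝ) (b : ℝ)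
    (x : E3) (t : ℝ) : ℝ :=
  deriv (fun s => thetabar Tbar b x s) t
    + (∑ i, ubar Ubar x t i * pd (fun y => thetabar Tbar b y t) i x)
    - lap (fun y => thetabar Tbar b y t) x

/-- The profile operator `a φ − ½ ξ·∇φ + (U·∇)φ − Δφ` in self-similar variables. -/
def profileOp (U : E3 → E3) (a : ℝ) (φ : E3 → ℝ) (ξ : E3) : ℝ :=
  a * φ ξ - 1 / 2 * fderiv ℝ φ ξ ξ + ∑ i, U ξ i * pd φ i ξ - lap φ ξ

lemma contDiff_pd_s13 {φ : E3 → ℝ} (hφ : ContDiff ℝ (⊤ : ℕ∞) φ) (i : Fin 3) :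
    ContDiff ℝ (⊤ : ℕ∞) (pd φ i) :=
  (hφ.fderiv_right (m := (⊤ : ℕ∞)) (by simp)).clm_apply contDiff_const

lemma tsupport_pd_subset (φ : E3 → ℝ) (i : Fin 3) : tsupport (pd φ i) ⊆ tsupport φ :=
  tsupport_fderiv_apply_subset ℝ _

lemma continuous_profileOp {U : E3 → E3} (hU : Continuous U) (a : ℝ) {φ : E3 → ℝ}
    (hφ : ContDiff ℝ (⊤ : ℕ∞) φ) : Continuous (profileOp U a φ) := by
  have h0 : Continuous φ := hφ.continuous
  have h1 : Continuous fun x => fderiv ℝ φ x x :=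
    (hφ.continuous_fderiv (by simp)).clm_apply continuous_id
  have h2 : ∀ i, Continuous (pd φ i) := fun i => (contDiff_pd_s13 hφ i).continuous
  have h3 : Continuous (lap φ) :=
    continuous_finsetSum _ fun i _ => (contDiff_pd_s13 (contDiff_pd_s13 hφ i) i).continuous
  unfold profileOp
  fun_prop

lemma hasCompactSupport_profileOp (U : E3 → E3) (a : ℝ) {φ : E3 → ℝ}
    (hφ : HasCompactSupport φ) : HasCompactSupport (profileOp U a φ) := by
  refine HasCompactSupport.intro hφ fun x hx => ?_
  have h0 : φ x = 0 := image_eq_zero_of_notMem_tsupport hx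
  have h1 : fderiv ℝ φ x = 0 :=
    image_eq_zero_of_notMem_tsupport fun h => hx (tsupport_fderiv_subset ℝ h)
  have h2 : ∀ i, pd φ i x = 0 := fun i =>
    image_eq_zero_of_notMem_tsupport fun h => hx (tsupport_pd_subset φ i h)
  have h3 : ∀ i, pd (pd φ i) i x = 0 := fun i =>
    image_eq_zero_of_notMem_tsupport fun h =>
      hx (tsupport_pd_subset φ i (tsupport_pd_subset _ i h))
  simp only [profileOp, lap, h0, h1, h2]
  simp [h3]

lemma pd_const_mul_comp_smul {φ : E3 → ℝ} (hφ : Differentiable ℝ φ) (c l : ℝ) (i : Fin 3)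
    (x : E3) : pd (fun y => c * φ (l • y)) i x = c * l * pd φ i (l • x) := by
  have h : HasFDerivAt (fun y : E3 => c * φ (l • y))
      (c • ((fderiv ℝ φ (l • x)).comp (l • ContinuousLinearMap.id ℝ E3))) x :=
    ((hφ (l • x)).hasFDerivAt.comp x ((hasFDerivAt_id x).const_smul l)).const_mul c
  simp [pd, h.fderiv, mul_assoc]

lemma lap_const_mul_comp_smul {φ : E3 → ℝ} (hφ : ContDiff ℝ (⊤ : ℕ∞) φ) (c l : ℝ) (x : E3) :
    lap (fun y => c * φ (l • y)) x = c * l ^ 2 * lap φ (l • x) := by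
  simp only [lap, pd_const_mul_comp_smul (hφ.differentiable (by simp)), Finset.mul_sum]
  refine Finset.sum_congr rfl fun i _ => ?_
  rw [pd_const_mul_comp_smul ((contDiff_pd_s13 hφ i).differentiable (by simp))]
  ring

lemma deriv_rpow_mul_comp_rpow_smul {φ : E3 → ℝ} (hφ : Differentiable ℝ φ) (a : ℝ) (x : E3)
    {t : ℝ} (ht : 0 < t) :
    deriv (fun s : ℝ => s ^ a * φ (s ^ (-(1:ℝ)/2) • x)) t =
      t ^ (a - 1) * (a * φ (t ^ (-(1:ℝ)/2) • x)
        - 1 / 2 * fderiv ℝ φ (t ^ (-(1:ℝ)/2) • x) (t ^ (-(1:ℝ)/2) • x)) := by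
  have h1 := Real.hasDerivAt_rpow_const (p := a) (Or.inl ht.ne')
  have h2 := Real.hasDerivAt_rpow_const (p := -(1:ℝ)/2) (Or.inl ht.ne')
  have h3 : HasDerivAt (fun s : ℝ => φ (s ^ (-(1:ℝ)/2) • x)) _ t :=
    (hφ (t ^ (-(1:ℝ)/2) • x)).hasFDerivAt.comp_hasDerivAt t (h2.smul_const x)
  rw [(h1.fun_mul h3).deriv]
  simp only [map_smul, smul_eq_mul]
  rw [Real.rpow_sub_one ht.ne', Real.rpow_sub_one ht.ne']
  ring

lemma profile_equation {U : E3 → E3} {φ : E3 → ℝ} (hφ : ContDiff ℝ (⊤ : ℕ∞) φ) (a : ℝ) (x : E3)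
    {t : ℝ} (ht : 0 < t) :
    deriv (fun s : ℝ => s ^ a * φ (s ^ (-(1:ℝ)/2) • x)) t
      + (∑ i, ubar U x t i * pd (fun y => t ^ a * φ (t ^ (-(1:ℝ)/2) • y)) i x)
      - lap (fun y => t ^ a * φ (t ^ (-(1:ℝ)/2) • y)) x
      = t ^ (a - 1) * profileOp U a φ (t ^ (-(1:ℝ)/2) • x) := by
  have hd := hφ.differentiable (by simp)
  have hl : (t ^ (-(1:ℝ)/2)) ^ 2 = t⁻¹ := by
    rw [← Real.rpow_natCast, ← Real.rpow_mul ht.le, ← Real.rpow_neg_one]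
    norm_num
  have hs : ∑ i, ubar U x t i * pd (fun y => t ^ a * φ (t ^ (-(1:ℝ)/2) • y)) i x
      = t ^ (a - 1) * ∑ i, U (t ^ (-(1:ℝ)/2) • x) i * pd φ i (t ^ (-(1:ℝ)/2) • x) := by
    rw [Finset.mul_sum]
    refine Finset.sum_congr rfl fun i _ => ?_
    rw [pd_const_mul_comp_smul hd, Real.rpow_sub_one ht.ne', div_eq_mul_inv (t ^ a), ← hl]
    simp only [ubar, PiLp.smul_apply, smul_eq_mul]
    ring
  rw [deriv_rpow_mul_comp_rpow_smul hd a x ht, hs, lap_const_mul_comp_smul hφ, hl, profileOp,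
    ← div_eq_mul_inv (t ^ a), ← Real.rpow_sub_one ht.ne']
  ring

/-- The buoyancy profile `Θ(ξ) ξⱼ / |ξ|³`. -/
def buoyancy (T : E3 → ℝ) (j : Fin 3) (ξ : E3) : ℝ := T ξ * (ξ j / ‖ξ‖ ^ 3)

lemma continuous_buoyancy {T : E3 → ℝ} (hT : Continuous T) (hT0 : tsupport T ⊆ {(0 : E3)}ᶜ)
    (j : Fin 3) : Continuous (buoyancy T j) := by
  refine continuous_of_tsupport fun x hx => ?_
  have hx0 : x ≠ 0 := hT0 (tsupport_mul_subset_left hx)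
  have hn : ‖x‖ ^ 3 ≠ 0 := pow_ne_zero _ (norm_ne_zero_iff.2 hx0)
  have hj : Continuous fun y : E3 => y j := by fun_prop
  exact hT.continuousAt.mul (hj.continuousAt.div (by fun_prop) hn)

lemma forceF_eq {U : E3 → E3} (hU : ContDiff ℝ (⊤ : ℕ∞) U) (T : E3 → ℝ) (b : ℝ) (x : E3)
    {t : ℝ} (ht : 0 < t) (j : Fin 3) :
    forceF U T b x t j = t ^ (-(3:ℝ)/2) *
      (profileOp U (-(1:ℝ)/2) (fun y => U y j) (t ^ (-(1:ℝ)/2) • x)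
        - t ^ b * buoyancy T j (t ^ (-(1:ℝ)/2) • x)) := by
  have hUj : ContDiff ℝ (⊤ : ℕ∞) fun y => U y j := by fun_prop
  have h := profile_equation (U := U) hUj (-(1:ℝ)/2) x ht
  have hpos : 0 < t ^ (-(1:ℝ)/2) := Real.rpow_pos_of_pos ht _
  have e1 : t ^ (-(3:ℝ)/2) = (t ^ (-(1:ℝ)/2)) ^ 3 := by
    rw [← Real.rpow_natCast, ← Real.rpow_mul ht.le]; norm_num
  have e2 : t ^ (b - 1/2) = t ^ b * t ^ (-(1:ℝ)/2) := by
    rw [← Real.rpow_add ht]; ring_nf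
  have hbuoy : thetabar T b x t * (x j / ‖x‖ ^ 3)
      = t ^ (-(3:ℝ)/2) * (t ^ b * buoyancy T j (t ^ (-(1:ℝ)/2) • x)) := by
    simp only [thetabar, buoyancy, norm_smul, PiLp.smul_apply, smul_eq_mul,
      Real.norm_of_nonneg hpos.le, e1, e2]
    rcases eq_or_ne x 0 with rfl | hx
    · simp
    · have := norm_ne_zero_iff.2 hx
      field_simp
  unfold forceF
  rw [hbuoy, mul_sub]
  congr 1
  rw [show -(3:ℝ)/2 = -(1:ℝ)/2 - 1 by norm_num, ← h]
  rfl

lemma sourceH_eq (U : E3 → E3) {T : E3 → ℝ} (hT : ContDiff ℝ (⊤ : ℕ∞) T) (b : ℝ) (x : E3)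
    {t : ℝ} (ht : 0 < t) :
    sourceH U T b x t = t ^ (-(3:ℝ)/2) *
      (t ^ b * profileOp U (b - 1/2) T (t ^ (-(1:ℝ)/2) • x)) := by
  rw [← mul_assoc, ← Real.rpow_add ht, show -(3:ℝ)/2 + b = b - 1/2 - 1 by ring,
    ← profile_equation hT (b - 1/2) x ht]
  rfl

lemma sqrt_integral_rpow_mul_comp_smul (V : E3 → ℝ) {t : ℝ} (ht : 0 < t) :
    √(∫ x : E3, (t ^ (-(3:ℝ)/2)) ^ 2 * V (t ^ (-(1:ℝ)/2) • x))
      = t ^ (-(3:ℝ)/4) * √(∫ x, V x) := by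
  have hpos : 0 < t ^ (-(1:ℝ)/2) := Real.rpow_pos_of_pos ht _
  have e : (t ^ (-(3:ℝ)/2)) ^ 2 * ((t ^ (-(1:ℝ)/2)) ^ 3)⁻¹ = (t ^ (-(3:ℝ)/4)) ^ 2 := by
    simp only [← Real.rpow_natCast, ← Real.rpow_mul ht.le, ← Real.rpow_neg ht.le,
      ← Real.rpow_add ht]
    norm_num
  rw [integral_const_mul, Measure.integral_comp_smul]
  simp only [finrank_euclideanSpace, Fintype.card_fin, smul_eq_mul]
  rw [abs_of_pos (by positivity), ← mul_assoc, e, Real.sqrt_mul (by positivity),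
    Real.sqrt_sq (by positivity)]

lemma bound_and_integrableOn {b : ℝ} (hb : 0 ≤ b) {A B D : ℝ} {F : ℝ → ℝ}
    (hF : ∀ t, 0 < t → F t = t ^ (-(3:ℝ)/4) * √(A + t ^ b * B + (t ^ b) ^ 2 * D)) :
    (∃ C, ∀ t, 0 < t → t ≤ 1 → F t ≤ C * t ^ (-(3:ℝ)/4)) ∧
      IntegrableOn F (Set.Ioo 0 1) := by
  have hle : ∀ t, 0 < t → t ≤ 1 → F t ≤ √(|A| + |B| + |D|) * t ^ (-(3:ℝ)/4) := by
    intro t ht ht1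
    have h0 : 0 ≤ t ^ b := Real.rpow_nonneg ht.le _
    have h1 : t ^ b ≤ 1 := Real.rpow_le_one ht.le ht1 hb
    have hB : t ^ b * B ≤ |B| := (mul_le_mul_of_nonneg_left (le_abs_self B) h0).trans
      (mul_le_of_le_one_left (abs_nonneg B) h1)
    have hD : (t ^ b) ^ 2 * D ≤ |D| :=
      (mul_le_mul_of_nonneg_left (le_abs_self D) (by positivity)).trans
        (mul_le_of_le_one_left (abs_nonneg D) (pow_le_one₀ h0 h1))
    rw [hF t ht, mul_comm]
    gcongr
    exact le_abs_self A
  refine ⟨⟨_, hle⟩, ?_⟩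
  have hint : IntegrableOn (fun t : ℝ => t ^ (-(3:ℝ)/4)) (Set.Ioo 0 1) :=
    (intervalIntegral.integrableOn_Ioo_rpow_iff one_pos).2 (by norm_num)
  refine (hint.const_mul √(|A| + |B| + |D|)).mono' ?_ ?_
  · have hm : Measurable fun t : ℝ =>
        t ^ (-(3:ℝ)/4) * √(A + t ^ b * B + (t ^ b) ^ 2 * D) := by fun_prop
    refine hm.aestronglyMeasurable.congr ?_
    filter_upwards [ae_restrict_mem measurableSet_Ioo] with t ht
    exact (hF t ht.1).symm
  · filter_upwards [ae_restrict_mem measurableSet_Ioo] with t ht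
    rw [Real.norm_of_nonneg (by rw [hF t ht.1]; have := ht.1; positivity)]
    exact hle t ht.1 ht.2.le

lemma exists_sqrt_integral_forceF_eq {U : E3 → E3} (hU : ContDiff ℝ (⊤ : ℕ∞) U)
    (hUc : HasCompactSupport U) {T : E3 → ℝ} (hT : Continuous T) (hTc : HasCompactSupport T)
    (hT0 : tsupport T ⊆ {(0 : E3)}ᶜ) (b : ℝ) :
    ∃ A B D : ℝ, ∀ t, 0 < t → √(∫ x : E3, ∑ j, forceF U T b x t j ^ 2)
      = t ^ (-(3:ℝ)/4) * √(A + t ^ b * B + (t ^ b) ^ 2 * D) := by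
  set G : Fin 3 → E3 → ℝ := fun j => profileOp U (-(1:ℝ)/2) fun y => U y j
  set K : Fin 3 → E3 → ℝ := buoyancy T
  have hG : ∀ j, Continuous (G j) := fun j =>
    continuous_profileOp hU.continuous _ (by fun_prop)
  have hGc : ∀ j, HasCompactSupport (G j) := fun j =>
    hasCompactSupport_profileOp U _ (hUc.comp_left (g := fun v : E3 => v j) rfl)
  have hK : ∀ j, Continuous (K j) := continuous_buoyancy hT hT0
  have hKc : ∀ j, HasCompactSupport (K j) := fun j => hTc.mul_right
  have iA : Integrable fun x => ∑ j, G j x * G j x := integrable_finsetSum _ fun j _ =>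
    ((hG j).mul (hG j)).integrable_of_hasCompactSupport (hGc j).mul_right
  have iB : Integrable fun x => ∑ j, -2 * (G j x * K j x) := integrable_finsetSum _ fun j _ =>
    (((hG j).mul (hK j)).integrable_of_hasCompactSupport (hGc j).mul_right).const_mul _
  have iD : Integrable fun x => ∑ j, K j x * K j x := integrable_finsetSum _ fun j _ =>
    ((hK j).mul (hK j)).integrable_of_hasCompactSupport (hKc j).mul_right
  refine ⟨∫ x, ∑ j, G j x * G j x, ∫ x, ∑ j, -2 * (G j x * K j x), ∫ x, ∑ j, K j x * K j x,
    fun t ht => ?_⟩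
  rw [← integral_const_mul, ← integral_const_mul, ← integral_add iA (iB.const_mul _),
    ← integral_add (by exact iA.add (iB.const_mul _)) (iD.const_mul _),
    ← sqrt_integral_rpow_mul_comp_smul _ ht]
  congr 2
  ext x
  simp only [forceF_eq hU T b x ht, Finset.mul_sum, ← Finset.sum_add_distrib]
  refine Finset.sum_congr rfl fun j _ => ?_
  ring

lemma sqrt_integral_sourceH_eq (U : E3 → E3) {T : E3 → ℝ} (hT : ContDiff ℝ (⊤ : ℕ∞) T) (b : ℝ)
    {t : ℝ} (ht : 0 < t) :
    √(∫ x : E3, sourceH U T b x t ^ 2) = t ^ (-(3:ℝ)/4) *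
      √(0 + t ^ b * 0 + (t ^ b) ^ 2 * ∫ x, profileOp U (b - 1/2) T x ^ 2) := by
  rw [mul_zero, zero_add, zero_add, ← integral_const_mul, ← sqrt_integral_rpow_mul_comp_smul _ ht]
  simp only [sourceH_eq U hT b _ ht, mul_pow]

/-- **`L¹_t L²_x` bound for the forcing of the self-similar profile.**  If `Ū ∈ C_c^∞` is
divergence-free, `Θ̄ ∈ C_c^∞` is supported away from the origin and `b ≥ 0`, then the force
`f` and heat source `h` generated by the profile `(ū, θ̄)` satisfy
`‖f(·,t)‖_{L²} + ‖h(·,t)‖_{L²} ≤ C t^{−3/4}` for `0 < t ≤ 1`; in particular both are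
integrable in time on `(0,1)`. -/
theorem profile_forcing_L1L2
    (Ubar : E3 → E3) (hU : ContDiff ℝ (⊤ : ℕ∞) Ubar) (hUc : HasCompactSupport Ubar)
    (hUdiv : ∀ x, divg Ubar x = 0)
    (Tbar : E3 → ℝ) (hT : ContDiff ℝ (⊤ : ℕ∞) Tbar) (hTc : HasCompactSupport Tbar)
    (hT0 : tsupport Tbar ⊆ {(0 : E3)}ᶜ)
    (b : ℝ) (hb : 0 ≤ b) :
    ∃ C : ℝ,
      (∀ t : ℝ, 0 < t → t ≤ 1 →
        Real.sqrt (∫ x : E3, ∑ j, forceF Ubar Tbar b x t j ^ 2)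
          + Real.sqrt (∫ x : E3, sourceH Ubar Tbar b x t ^ 2)
        ≤ C * t ^ (-(3:ℝ)/4)) ∧
      IntegrableOn
        (fun t : ℝ => Real.sqrt (∫ x : E3, ∑ j, forceF Ubar Tbar b x t j ^ 2))
        (Set.Ioo 0 1) volume ∧
      IntegrableOn
        (fun t : ℝ => Real.sqrt (∫ x : E3, sourceH Ubar Tbar b x t ^ 2))
        (Set.Ioo 0 1) volume := by
  obtain ⟨A, B, D, hF⟩ := exists_sqrt_integral_forceF_eq hU hUc hT.continuous hTc hT0 b
  obtain ⟨⟨Cf, hf⟩, hfi⟩ := bound_and_integrableOn hb hF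
  obtain ⟨⟨Ch, hh⟩, hhi⟩ := bound_and_integrableOn hb fun t => sqrt_integral_sourceH_eq Ubar hT b
  refine ⟨Cf + Ch, fun t ht ht1 => ?_, hfi, hhi⟩
  exact (add_le_add (hf t ht ht1) (hh t ht ht1)).trans_eq (add_mul _ _ _).symm
end
end
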